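/- Let n ≥ 1 and let 0 ≤ μ < 1. There exists a constant C, depending only on n and μ, such that for every point z ∈ ℂⁿ and all positive real numbers r₁, …, r_n, the polydisc P = { ζ ∈ ℂⁿ : |ζ_j − z_j| < r_j for j = 1, …, n } satisfies ∫_P |z − ζ|^{−(1+μ)} dλ(ζ) ≤ C · r_n^{1−μ} · ∏_{j=1}^{n−1} r_j², where |z − ζ| denotes the Euclidean norm of z − ζ in ℂⁿ and λ denotes Lebesgue measure on ℂⁿ ≅ ℝ^{2n}. -/

import Mathlib

open MeasureTheory Metric ENNReal

/-- The integral of `‖w - x‖ ^ (-(1 + μ))` over the disc of radius `R` centered at `w`. -/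
theorem lintegral_ball_nnnorm_sub_rpow (w : ℂ) {R μ : ℝ} (hR : 0 < R) (hμ : μ < 1) :
    ∫⁻ x in ball w R, (‖w - x‖₊ : ℝ≥0∞) ^ (-(1 + μ)) =
      ENNReal.ofReal (2 * Real.pi * (R ^ (1 - μ) / (1 - μ))) := by
  have hint : IntegrableOn (fun t : ℝ => t ^ (-μ)) (Set.Ioo 0 R) :=
    ((intervalIntegrable_iff_integrableOn_Ioo_of_le hR.le).1
      (intervalIntegral.intervalIntegrable_rpow' (by linarith)))
  have hradial : ∫⁻ t in Set.Ioo 0 R, ENNReal.ofReal (t ^ (-μ)) =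
      ENNReal.ofReal (R ^ (1 - μ) / (1 - μ)) := by
    rw [← ofReal_integral_eq_lintegral_ofReal hint, ← integral_Ioc_eq_integral_Ioo,
      ← intervalIntegral.integral_of_le hR.le, integral_rpow (Or.inl (by linarith)),
      Real.zero_rpow (by linarith), sub_zero, neg_add_eq_sub]
    filter_upwards [ae_restrict_mem measurableSet_Ioo] with t ht
    exact Real.rpow_nonneg ht.1.le _
  have htrans : ∫⁻ x in ball w R, (‖w - x‖₊ : ℝ≥0∞) ^ (-(1 + μ)) =
      ∫⁻ x, (ball (0 : ℂ) R).indicator (fun x => (‖x‖₊ : ℝ≥0∞) ^ (-(1 + μ))) x := by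
    rw [← lintegral_indicator measurableSet_ball, ← lintegral_add_right_eq_self _ w]
    refine lintegral_congr fun x => ?_
    simp only [Set.indicator, mem_ball, dist_eq_norm, sub_zero, add_sub_cancel_right,
      sub_add_cancel_right, nnnorm_neg]
  have hpolar : ∀ p ∈ polarCoord.target,
      ENNReal.ofReal p.1 • (ball (0 : ℂ) R).indicator
          (fun x => (‖x‖₊ : ℝ≥0∞) ^ (-(1 + μ))) (Complex.polarCoord.symm p) =
        (Set.Iio R ×ˢ Set.univ).indicator
          (fun q : ℝ × ℝ => ENNReal.ofReal (q.1 ^ (-μ))) p := by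
    rintro ⟨t, θ⟩ ⟨ht, -⟩
    have ht : 0 < t := ht
    have hn : ‖Complex.polarCoord.symm (t, θ)‖ = t := by
      rw [Complex.norm_polarCoord_symm, abs_of_pos ht]
    simp only [Set.indicator, mem_ball, dist_zero_right, hn, Set.mem_prod, Set.mem_Iio,
      Set.mem_univ, and_true]
    split_ifs
    · rw [← enorm_eq_nnnorm, ← ofReal_norm, hn, ENNReal.ofReal_rpow_of_pos ht, smul_eq_mul,
        ← ENNReal.ofReal_mul ht.le]
      congr 1
      nth_rewrite 1 [← Real.rpow_one t]
      rw [← Real.rpow_add ht]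
      congr 1
      ring
    · simp
  have htarget : Set.Iio R ×ˢ Set.univ ∩ polarCoord.target =
      Set.Ioo 0 R ×ˢ Set.Ioo (-Real.pi) Real.pi := by
    ext ⟨t, θ⟩
    simp [polarCoord_target]
    tauto
  rw [htrans, ← Complex.lintegral_comp_polarCoord_symm,
    setLIntegral_congr_fun polarCoord.open_target.measurableSet hpolar,
    lintegral_indicator (measurableSet_Iio.prod MeasurableSet.univ),
    Measure.restrict_restrict (measurableSet_Iio.prod MeasurableSet.univ), htarget,
    Measure.volume_eq_prod, ← Measure.prod_restrict]
  have hprod := lintegral_prod_mul (μ := volume.restrict (Set.Ioo 0 R))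
    (ν := volume.restrict (Set.Ioo (-Real.pi) Real.pi))
    (f := fun t : ℝ => ENNReal.ofReal (t ^ (-μ))) (g := fun _ => 1)
    (by fun_prop) aemeasurable_const
  simp only [mul_one] at hprod
  rw [hprod, hradial, setLIntegral_one, Real.volume_Ioo, ← ENNReal.ofReal_mul (by
    have := Real.rpow_nonneg hR.le (1 - μ)
    exact div_nonneg this (by linarith))]
  congr 1
  ring

/-- Integrating a function of the last coordinate over a box. -/
theorem setLIntegral_pi_comp_last {n : ℕ} {α : Type*} [MeasureSpace α]
    [SigmaFinite (volume : Measure α)] (s : Fin (n + 1) → Set α)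
    (hs : ∀ j, volume (s j) ≠ ∞) {f : α → ℝ≥0∞} (hf : Measurable f) :
    ∫⁻ w in Set.univ.pi s, f (w (Fin.last n)) =
      (∏ j : Fin n, volume (s j.castSucc)) * ∫⁻ x in s (Fin.last n), f x := by
  have hfin : ∀ j, IsFiniteMeasure (volume.restrict (s j)) := fun j =>
    isFiniteMeasure_restrict.2 (hs j)
  rw [volume_pi, Measure.restrict_pi_pi,
    ← lintegral_map (μ := Measure.pi _) hf (measurable_pi_apply (Fin.last n))]
  have h := Measure.pi_map_eval (μ := fun j => volume.restrict (s j)) (Fin.last n)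
  rw [show (fun w : Fin (n + 1) → α => w (Fin.last n)) = Function.eval (Fin.last n) from rfl, h,
    lintegral_smul_measure, smul_eq_mul]
  congr 1
  rw [← Finset.compl_singleton, ← Fin.image_castSucc,
    Finset.prod_image (fun _ _ _ _ h => Fin.castSucc_injective _ h)]
  simp

/-- For `0 ≤ μ < 1` there is a constant `C = C(n,μ)` such that for every
polydisc `P = {ζ : |ζ_j - z_j| < r_j}` in `ℂ^{n+1}`,
`∫_P |z - ζ|^{-(1+μ)} dλ(ζ) ≤ C · r_{n+1}^{1-μ} · ∏_{j=1}^{n} r_j²`,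
where the norm is the Euclidean norm and `λ` is Lebesgue measure. -/
theorem polydisc_integral_estimate (n : ℕ)
    [MeasurableSpace (EuclideanSpace ℂ (Fin (n + 1)))]
    [BorelSpace (EuclideanSpace ℂ (Fin (n + 1)))]
    (μ : ℝ) (hμ0 : 0 ≤ μ) (hμ1 : μ < 1) :
    ∃ C > (0 : ℝ), ∀ (z : EuclideanSpace ℂ (Fin (n + 1))) (r : Fin (n + 1) → ℝ),
      (∀ j, 0 < r j) →
      (∫⁻ ζ in {ζ : EuclideanSpace ℂ (Fin (n + 1)) | ∀ j, ‖ζ j - z j‖ < r j},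
          (‖z - ζ‖₊ : ℝ≥0∞) ^ (-(1 + μ)))
        ≤ ENNReal.ofReal
            (C * r (Fin.last n) ^ (1 - μ) * ∏ j : Fin n, (r j.castSucc) ^ 2) := by
  let L := PiLp.continuousLinearEquiv 2 ℝ (fun _ : Fin (n + 1) => ℂ)
  let ν := Measure.map L (volume : Measure (EuclideanSpace ℂ (Fin (n + 1))))
  have : ν.IsAddHaarMeasure := L.isAddHaarMeasure_map _
  let c := Measure.addHaarScalarFactor ν volume
  have hc : 0 < c := Measure.addHaarScalarFactor_pos_of_isAddHaarMeasure _ _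
  have hν : ν = c • volume := Measure.isAddLeftInvariant_eq_smul _ _
  have hμ : 0 < 1 - μ := sub_pos.2 hμ1
  refine ⟨c * (Real.pi ^ n * (2 * Real.pi / (1 - μ))), by positivity, fun z r hr => ?_⟩
  let F : (Fin (n + 1) → ℂ) → ℝ≥0∞ := fun w =>
    (‖z (Fin.last n) - w (Fin.last n)‖₊ : ℝ≥0∞) ^ (-(1 + μ))
  have hP : MeasurableSet (Set.univ.pi fun j => ball (z j) (r j)) :=
    MeasurableSet.univ_pi fun _ => measurableSet_ball
  have hF : Measurable F := by fun_prop
  calc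
    _ ≤ ∫⁻ ζ in L ⁻¹' (Set.univ.pi fun j => ball (z j) (r j)), F (L ζ) := by
      have hset : {ζ : EuclideanSpace ℂ (Fin (n + 1)) | ∀ j, ‖ζ j - z j‖ < r j} =
          L ⁻¹' (Set.univ.pi fun j => ball (z j) (r j)) := by
        ext ζ
        simp [L, dist_eq_norm]
      rw [hset]
      refine lintegral_mono fun ζ => ?_
      simp only [F, ENNReal.rpow_neg]
      refine ENNReal.inv_le_inv.2 (ENNReal.rpow_le_rpow ?_ (by linarith))
      exact ENNReal.coe_le_coe.2 (PiLp.norm_apply_le (z - ζ) (Fin.last n))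
    _ = ∫⁻ w in Set.univ.pi fun j => ball (z j) (r j), F w ∂ν :=
      (setLIntegral_map hP hF L.continuous.measurable).symm
    _ = c * ((∏ j : Fin n, volume (ball (z j.castSucc) (r j.castSucc))) *
          ∫⁻ x in ball (z (Fin.last n)) (r (Fin.last n)),
            (‖z (Fin.last n) - x‖₊ : ℝ≥0∞) ^ (-(1 + μ))) := by
      rw [hν, Measure.restrict_smul, lintegral_smul_measure, ENNReal.smul_def, smul_eq_mul,
        ← setLIntegral_pi_comp_last (fun j => ball (z j) (r j))
          (fun _ => measure_ball_lt_top.ne)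
          (f := fun x => (‖z (Fin.last n) - x‖₊ : ℝ≥0∞) ^ (-(1 + μ))) (by fun_prop)]
    _ = _ := by
      have hvol : ∀ j : Fin n, volume (ball (z j.castSucc) (r j.castSucc)) =
          ENNReal.ofReal (r j.castSucc ^ 2 * Real.pi) := fun j => by
        rw [Complex.volume_ball, ENNReal.ofReal_mul (by positivity),
          ENNReal.ofReal_pow (hr _).le, ← NNReal.coe_real_pi, ENNReal.ofReal_coe_nnreal]
      have hrl := Real.rpow_nonneg (hr (Fin.last n)).le (1 - μ)
      rw [lintegral_ball_nnnorm_sub_rpow _ (hr _) hμ1, Finset.prod_congr rfl fun j _ => hvol j,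
        ← ENNReal.ofReal_prod_of_nonneg (fun _ _ => by positivity),
        ← ENNReal.ofReal_mul (Finset.prod_nonneg fun _ _ => by positivity),
        ← ENNReal.ofReal_coe_nnreal, ← ENNReal.ofReal_mul c.coe_nonneg, Finset.prod_mul_distrib,
        Finset.prod_const, Finset.card_univ, Fintype.card_fin]
      congr 1
      ring
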